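/- arXiv:1710.04407 — 2 statements merged into one kernel-verified Lean document; each statement's English description precedes it below -/
import Mathlib

section
/- Let b > 0 and let m be a positive integer. Let z be a nonnegative real random variable with E[z] = m and Var[z] = 2m. Then for every real s ≥ 0, E[(max(0, s + z − b))²] ≤ s² − 2(b − m)s + (b − m)² + 2m. Consequently, if b > m and s > ((b − m)² + 2m)/(2(b − m)), then E[(max(0, s + z − b))²] < s². -/
open MeasureTheory ProbabilityTheory

/-- one-step drift inequality for the CUSUM statistic.
For a nonnegative random variable `z` with `E[z] = m` and `Var[z] = 2m`, and any `s ≥ 0`,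
`E[(max 0 (s + z − b))²] ≤ s² − 2(b − m)s + (b − m)² + 2m`; consequently, if `b > m` and
`s > ((b − m)² + 2m)/(2(b − m))`, then `E[(max 0 (s + z − b))²] < s²`. -/
theorem cusum_one_step_drift
    {Ω : Type*} [MeasureSpace Ω] [IsProbabilityMeasure (ℙ : Measure Ω)]
    (b : ℝ) (hb : 0 < b) (m : ℕ) (hm : 0 < m)
    (z : Ω → ℝ)
    (hzmeas : Measurable z)
    (hint : Integrable z)
    (hint2 : Integrable (fun ω => (z ω) ^ 2))
    (hnonneg : ∀ ω, 0 ≤ z ω)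
    (hmean : (∫ ω, z ω) = (m : ℝ))
    (hvar : (∫ ω, (z ω - (m : ℝ)) ^ 2) = 2 * (m : ℝ)) :
    (∀ s : ℝ, 0 ≤ s →
      (∫ ω, (max 0 (s + z ω - b)) ^ 2) ≤
        s ^ 2 - 2 * (b - (m : ℝ)) * s + (b - (m : ℝ)) ^ 2 + 2 * (m : ℝ)) ∧
    ((m : ℝ) < b → ∀ s : ℝ, ((b - (m : ℝ)) ^ 2 + 2 * (m : ℝ)) / (2 * (b - (m : ℝ))) < s →
      (∫ ω, (max 0 (s + z ω - b)) ^ 2) < s ^ 2) := by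
  have hd : Integrable (fun ω => z ω - (m : ℝ)) := hint.sub (integrable_const _)
  have hd0 : (∫ ω, (z ω - (m : ℝ))) = 0 := by
    rw [integral_sub hint (integrable_const _), hmean]; simp
  have hd2 : Integrable (fun ω => (z ω - (m : ℝ)) ^ 2) := by
    have h : Integrable (fun ω => (z ω) ^ 2 - (2 * (m : ℝ)) * z ω + (m : ℝ) ^ 2) :=
      (hint2.sub (hint.const_mul _)).add (integrable_const _)
    refine h.congr (Filter.Eventually.of_forall fun ω => ?_)
    simp only
    ring
  have key : ∀ s : ℝ, (∫ ω, (max 0 (s + z ω - b)) ^ 2) ≤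
        s ^ 2 - 2 * (b - (m : ℝ)) * s + (b - (m : ℝ)) ^ 2 + 2 * (m : ℝ) := by
    intro s
    have hi1 : Integrable (fun ω => (z ω - (m : ℝ)) ^ 2
        + (2 * (s + m - b)) * (z ω - (m : ℝ))) := hd2.add (hd.const_mul _)
    have hi : Integrable (fun ω => (z ω - (m : ℝ)) ^ 2
        + (2 * (s + m - b)) * (z ω - (m : ℝ)) + (s + m - b) ^ 2) :=
      hi1.add (integrable_const _)
    have hle : (∫ ω, (max 0 (s + z ω - b)) ^ 2) ≤ ∫ ω, ((z ω - (m : ℝ)) ^ 2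
        + (2 * (s + m - b)) * (z ω - (m : ℝ)) + (s + m - b) ^ 2) := by
      refine integral_mono_of_nonneg (Filter.Eventually.of_forall fun ω => sq_nonneg _) hi
        (Filter.Eventually.of_forall fun ω => ?_)
      simp only
      rcases max_cases 0 (s + z ω - b) with ⟨h, _⟩ | ⟨h, _⟩ <;> rw [h] <;>
        nlinarith [sq_nonneg (s + z ω - b)]
    rw [integral_add hi1 (integrable_const _), integral_add hd2 (hd.const_mul _),
      integral_const_mul, hd0, hvar] at hle
    simp at hle
    linarith
  refine ⟨fun s _ => key s, fun hbm s hs => (key s).trans_lt ?_⟩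
  rw [div_lt_iff₀ (by linarith)] at hs
  linarith
end

section
/- Let n, m be positive integers, and let F ∈ ℝ^{n×n}, L ∈ ℝ^{n×m}, C ∈ ℝ^{m×n}, and let Σ ∈ ℝ^{m×m} be symmetric positive definite with symmetric square root Σ^{1/2}. Let k* ≥ 1, let α > 0, let (η_k), (δ̄_k) be sequences in ℝ^m with ‖δ̄_k‖² ≤ α for all k ≥ k*, let (v_k) be a sequence in ℝ^n, and let (e_k)_{k≥k*} in ℝ^n satisfy e_{k+1} = (F − L C) e_k − L η_k + v_k − L δ_k, where the attack sequence is δ_k := −C e_k − η_k + Σ^{1/2} δ̄_k for k ≥ k*. Then for every k ≥ k*: (i) the residual r_k := C e_k + η_k + δ_k equals Σ^{1/2} δ̄_k; (ii) the distance measure z_k := r_k^T Σ^{-1} r_k equals δ̄_k^T δ̄_k and hence satisfies z_k ≤ α; and (iii) the error obeys e_{k+1} = F e_k − L Σ^{1/2} δ̄_k + v_k. -/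
open Matrix

/-- zero-alarm attacks against the chi-squared detector. Under the attack
`δ_k = −C e_k − η_k + Σ^{1/2} δ̄_k` with `‖δ̄_k‖² ≤ α`, the residual equals `Σ^{1/2} δ̄_k`,
the distance measure equals `δ̄_kᵀ δ̄_k ≤ α`, and the estimation error obeys
`e_{k+1} = F e_k − L Σ^{1/2} δ̄_k + v_k`. -/
theorem zero_alarm_attack_chi_squared
    (n m : ℕ) (hn : 0 < n) (hm : 0 < m)
    (F : Matrix (Fin n) (Fin n) ℝ) (L : Matrix (Fin n) (Fin m) ℝ)
    (C : Matrix (Fin m) (Fin n) ℝ)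
    (Sig Sighalf : Matrix (Fin m) (Fin m) ℝ)
    (hSig : Sig.PosDef)
    (hSighalfSymm : Sighalf.IsSymm)
    (hSighalfSq : Sighalf * Sighalf = Sig)
    (kstar : ℕ) (hkstar : 1 ≤ kstar)
    (α : ℝ) (hα : 0 < α)
    (η : ℕ → Fin m → ℝ) (v : ℕ → Fin n → ℝ)
    (δbar : ℕ → Fin m → ℝ)
    (hδbar : ∀ k, kstar ≤ k → δbar k ⬝ᵥ δbar k ≤ α)
    (e : ℕ → Fin n → ℝ) (δ : ℕ → Fin m → ℝ)
    (hδ : ∀ k, kstar ≤ k → δ k = -(C *ᵥ e k) - η k + Sighalf *ᵥ δbar k)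
    (herec : ∀ k, kstar ≤ k →
      e (k + 1) = (F - L * C) *ᵥ e k - L *ᵥ η k + v k - L *ᵥ δ k) :
    ∀ k, kstar ≤ k →
      (C *ᵥ e k + η k + δ k = Sighalf *ᵥ δbar k) ∧
      ((C *ᵥ e k + η k + δ k) ⬝ᵥ (Sig⁻¹ *ᵥ (C *ᵥ e k + η k + δ k)) = δbar k ⬝ᵥ δbar k ∧
        (C *ᵥ e k + η k + δ k) ⬝ᵥ (Sig⁻¹ *ᵥ (C *ᵥ e k + η k + δ k)) ≤ α) ∧
      e (k + 1) = F *ᵥ e k - L *ᵥ (Sighalf *ᵥ δbar k) + v k := by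
  intro k hk
  have hr : C *ᵥ e k + η k + δ k = Sighalf *ᵥ δbar k := by
    rw [hδ k hk]; abel
  have hu : IsUnit Sighalf.det := by
    have h1 : Sighalf.det * Sighalf.det = Sig.det := by rw [← det_mul, hSighalfSq]
    have h2 := hSig.det_pos
    rw [isUnit_iff_ne_zero]
    intro h0
    rw [h0] at h1
    linarith
  have hz : (C *ᵥ e k + η k + δ k) ⬝ᵥ (Sig⁻¹ *ᵥ (C *ᵥ e k + η k + δ k))
      = δbar k ⬝ᵥ δbar k := by
    have h3 : Sig⁻¹ *ᵥ (Sighalf *ᵥ δbar k) = Sighalf⁻¹ *ᵥ δbar k := by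
      rw [← hSighalfSq, Matrix.mul_inv_rev, mulVec_mulVec, Matrix.mul_assoc,
        nonsing_inv_mul _ hu, Matrix.mul_one]
    have h4 : Sighalf *ᵥ δbar k = δbar k ᵥ* Sighalf := by
      conv_lhs => rw [← hSighalfSymm.eq]
      rw [mulVec_transpose]
    rw [hr, h3, h4, ← dotProduct_mulVec, mulVec_mulVec, mul_nonsing_inv _ hu, one_mulVec]
  refine ⟨hr, ⟨hz, hz.le.trans (hδbar k hk)⟩, ?_⟩
  rw [herec k hk, hδ k hk, sub_mulVec, mulVec_add, mulVec_sub, mulVec_neg, mulVec_mulVec]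
  abel
end
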